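/- Let G be a countable group. Every frame representation of G on a separable complex Hilbert space is central if and only if G is abelian. -/

import Mathlib

noncomputable section

open scoped ENNReal

local notation "⟪" x ", " y "⟫" => @inner ℂ _ _ x y

/-- The Hilbert space `ℓ²(S)` of square-summable complex functions on `S`. -/
abbrev l2 (S : Type*) : Type _ := lp (fun _ : S => ℂ) 2

/-- The standard orthonormal basis vector `δ_t ∈ ℓ²(S)`. -/
def sdelta {S : Type*} [DecidableEq S] (t : S) : l2 S := lp.single 2 t 1

/-- The family `(f s)_{s ∈ S}` is a frame for `H`. -/
def IsFrame {S H : Type*} [NormedAddCommGroup H] [InnerProductSpace ℂ H] (f : S → H) : Prop :=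
  ∃ C₁ C₂ : ℝ, 0 < C₁ ∧ C₁ ≤ C₂ ∧ ∀ x : H,
    (C₁ * ‖x‖ ^ 2 ≤ ∑' s, ‖⟪x, f s⟫‖ ^ 2) ∧ (∑' s, ‖⟪x, f s⟫‖ ^ 2 ≤ C₂ * ‖x‖ ^ 2)

/-- The family `(f s)_{s ∈ S}` is a Bessel sequence in `H`. -/
def IsBessel {S H : Type*} [NormedAddCommGroup H] [InnerProductSpace ℂ H] (f : S → H) : Prop :=
  ∃ C₂ : ℝ, 0 < C₂ ∧ ∀ x : H, ∑' s, ‖⟪x, f s⟫‖ ^ 2 ≤ C₂ * ‖x‖ ^ 2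

/-- `π` is a representation of the monoid `S` on `H`: `π 1 = 1` and `π (s*t) = π s ∘ π t`. -/
def IsRepn {S H : Type*} [Monoid S] [NormedAddCommGroup H] [InnerProductSpace ℂ H]
    (π : S → (H →L[ℂ] H)) : Prop :=
  π 1 = 1 ∧ ∀ s t : S, π (s * t) = π s * π t

/-- `Θ` is the analysis operator of the family `(π s ξ)_{s ∈ S}`:
`Θ x = (⟨x, π s ξ⟩)_{s ∈ S}`. -/
def IsAnalysisOp {S H : Type*} [NormedAddCommGroup H] [InnerProductSpace ℂ H]
    (π : S → (H →L[ℂ] H)) (ξ : H) (Θ : H →L[ℂ] l2 S) : Prop :=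
  ∀ (x : H) (s : S), Θ x s = ⟪x, π s ξ⟫

/-- `lam` is the left regular representation of `S` on `ℓ²(S)`: `lam s δ_t = δ_{s*t}`. -/
def IsLeftRegularRepn {S : Type*} [Monoid S] [DecidableEq S]
    (lam : S → (l2 S →L[ℂ] l2 S)) : Prop :=
  ∀ s t : S, lam s (sdelta t) = sdelta (s * t)

/-- The subspace `M` is co-invariant under `lam`: `Mᗮ` is invariant under every `lam s`. -/
def IsCoinvariant {S : Type*} (lam : S → (l2 S →L[ℂ] l2 S)) (M : Submodule ℂ (l2 S)) : Prop :=
  ∀ s : S, ∀ y ∈ Mᗮ, lam s y ∈ Mᗮ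

/-- `M` is co-hyperinvariant under `lam`: `Mᗮ` is invariant under every `lam s` and, in addition,
under every bounded operator commuting with all the `lam s`. -/
def IsCoHyperinvariant {S : Type*} (lam : S → (l2 S →L[ℂ] l2 S))
    (M : Submodule ℂ (l2 S)) : Prop :=
  IsCoinvariant lam M ∧
    ∀ B : l2 S →L[ℂ] l2 S, (∀ s : S, B * lam s = lam s * B) → ∀ y ∈ Mᗮ, B y ∈ Mᗮ

/-- The representation `π` is central: any two frame vectors are equivalent, i.e. there is a
bounded invertible operator commuting with the representation carrying one to the other. -/
def IsCentral {S H : Type*} [NormedAddCommGroup H] [InnerProductSpace ℂ H]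
    (π : S → (H →L[ℂ] H)) : Prop :=
  ∀ ξ η : H, IsFrame (fun s => π s ξ) → IsFrame (fun s => π s η) →
    ∃ T : H ≃L[ℂ] H, (∀ (s : S) (x : H), T (π s x) = π s (T x)) ∧ T ξ = η

section Reduced

variable {A : Type*} [CStarAlgebra A]

/-- In a C⋆-algebra without square-zero elements, a commutator with a self-adjoint element is
arbitrarily small relative to the norms of the two factors. -/
lemma norm_commutator_sq_le (hA : ∀ x : A, x * x = 0 → x = 0) (u : A) (n : ℕ) :
    ∀ (r : ℝ) (t : A), IsSelfAdjoint t → ‖t‖ ≤ r →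
      ‖t * u - u * t‖ ^ 2 ≤ 4 * r ^ 2 * ‖u‖ ^ 2 / 2 ^ n := by
  induction n with
  | zero =>
    intro r t _ hr
    have h1 : ‖t * u - u * t‖ ≤ 2 * r * ‖u‖ := by
      calc ‖t * u - u * t‖ ≤ ‖t‖ * ‖u‖ + ‖u‖ * ‖t‖ :=
            (norm_sub_le _ _).trans (add_le_add (norm_mul_le _ _) (norm_mul_le _ _))
        _ = 2 * ‖t‖ * ‖u‖ := by ring
        _ ≤ 2 * r * ‖u‖ := by gcongr
    calc ‖t * u - u * t‖ ^ 2 ≤ (2 * r * ‖u‖) ^ 2 := by gcongr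
      _ = _ := by ring
  | succ n ih =>
    intro r t ht hr
    have hr0 : 0 ≤ r := (norm_nonneg t).trans hr
    have hspec : ∀ x ∈ spectrum ℝ t, |x| ≤ r := fun x hx => by
      have h := norm_apply_le_norm_cfc (id : ℝ → ℝ) t hx
      rw [cfc_id ℝ t] at h
      exact h.trans hr
    set p : A := cfc (fun x : ℝ => max x 0) t with hp
    set q : A := cfc (fun x : ℝ => max (-x) 0) t with hq
    have hpsa : IsSelfAdjoint p := cfc_predicate _ _
    have hqsa : IsSelfAdjoint q := cfc_predicate _ _
    have hpq : p - q = t := by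
      rw [hp, hq, ← cfc_sub _ _ t]
      conv_rhs => rw [← cfc_id ℝ t]
      congr 1
      ext x
      rcases le_total x 0 with h | h <;> simp [h]
    have hpq0 : p * q = 0 := by
      rw [hp, hq, ← cfc_mul _ _ t, ← cfc_const_zero ℝ t]
      congr 1
      ext x
      rcases le_total x 0 with h | h <;> simp [h]
    have hqp0 : q * p = 0 := by
      simpa [hpsa.star_eq, hqsa.star_eq] using congrArg star hpq0
    have hpuq : ∀ v : A, p * v * q = 0 := fun v => hA _ (by
      rw [show p * v * q * (p * v * q) = p * v * (q * p) * v * q by noncomm_ring, hqp0]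
      simp)
    have key : ∀ (f : ℝ → ℝ), Continuous f → (∀ x, |x| ≤ r → |f x - r / 2| ≤ r / 2) →
        ‖cfc f t * u - u * cfc f t‖ ^ 2 ≤ 4 * (r / 2) ^ 2 * ‖u‖ ^ 2 / 2 ^ n := by
      intro f hf hfr
      have h1 : cfc (fun x => f x - r / 2) t = cfc f t - algebraMap ℝ A (r / 2) := by
        rw [cfc_sub _ _ t, cfc_const _ t]
      have h2 := ih (r / 2) (cfc (fun x => f x - r / 2) t) (cfc_predicate _ _)
        (norm_cfc_le (by positivity) fun x hx => hfr x (hspec x hx))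
      rwa [h1, sub_mul, mul_sub, Algebra.commutes, sub_sub_sub_cancel_right] at h2
    have hX := key (fun x => max x 0) (by fun_prop) (fun x hx => by
      rw [abs_le] at hx ⊢
      rcases le_total x 0 with h | h <;> simp only [max_eq_left, max_eq_right, h] <;>
        constructor <;> linarith)
    have hY := key (fun x => max (-x) 0) (by fun_prop) (fun x hx => by
      rw [abs_le] at hx ⊢
      rcases le_total x 0 with h | h <;>
        simp only [max_eq_left, max_eq_right, h, Left.nonneg_neg_iff, Left.neg_nonpos_iff] <;>
        constructor <;> linarith)
    rw [← hp] at hX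
    rw [← hq] at hY
    set x := p * u - u * p with hx
    set y := q * u - u * q with hy
    have hxy : t * u - u * t = x - y := by rw [hx, hy, ← hpq]; noncomm_ring
    have hsx : star x * y = 0 := by
      have : star x * y = star u * (p * q) * u - star u * (p * u * q) - p * star u * q * u
          + p * (star u * u) * q := by
        rw [hx, hy, star_sub, star_mul, star_mul, hpsa.star_eq]; noncomm_ring
      rw [this, hpq0, hpuq, hpuq, hpuq]; simp
    have hsy : star y * x = 0 := by simpa using congrArg star hsx
    have hsum : ‖x - y‖ ^ 2 ≤ ‖x‖ ^ 2 + ‖y‖ ^ 2 := by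
      have h : star (x - y) * (x - y) = star x * x + star y * y := by
        rw [star_sub, sub_mul, mul_sub _ x y, mul_sub _ x y, hsx, hsy]; abel
      rw [sq, sq, sq, ← CStarRing.norm_star_mul_self, ← CStarRing.norm_star_mul_self,
        ← CStarRing.norm_star_mul_self, h]
      exact norm_add_le _ _
    rw [hxy]
    calc ‖x - y‖ ^ 2 ≤ _ := hsum
      _ ≤ _ := add_le_add hX hY
      _ = _ := by rw [pow_succ]; field_simp; ring

/-- **Kaplansky**: a C⋆-algebra without nonzero square-zero elements is commutative. -/
lemma mul_comm_of_forall_sq_eq_zero (hA : ∀ x : A, x * x = 0 → x = 0) (a b : A) :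
    a * b = b * a := by
  have key : ∀ t : A, IsSelfAdjoint t → t * b = b * t := fun t ht => by
    have hlim : Filter.Tendsto (fun n : ℕ => 4 * ‖t‖ ^ 2 * ‖b‖ ^ 2 / 2 ^ n) Filter.atTop
        (nhds 0) :=
      tendsto_const_nhds.div_atTop (tendsto_pow_atTop_atTop_of_one_lt one_lt_two)
    have h := ge_of_tendsto' hlim fun n => norm_commutator_sq_le hA b n ‖t‖ t ht le_rfl
    exact sub_eq_zero.mp (norm_eq_zero.mp (pow_eq_zero_iff two_ne_zero |>.mp
      (le_antisymm h (sq_nonneg _))))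
  rw [← realPart_add_I_smul_imaginaryPart a]
  simp [add_mul, mul_add, key _ (realPart a).2, key _ (imaginaryPart a).2]

end Reduced

lemma eq_zero_of_mul_norm_sq_le_zero {E : Type*} [NormedAddCommGroup E] {c : ℝ} (hc : 0 < c)
    {x : E} (h : c * ‖x‖ ^ 2 ≤ 0) : x = 0 := by
  by_contra hx
  have := norm_pos_iff.mpr hx
  exact h.not_gt (by positivity)

section Frame

variable {S H : Type*} [NormedAddCommGroup H] [InnerProductSpace ℂ H]

lemma IsFrame.summable {f : S → H} (hf : IsFrame f) (x : H) :
    Summable fun s => ‖⟪f s, x⟫‖ ^ 2 := by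
  obtain ⟨C₁, C₂, h1, -, h⟩ := hf
  simp_rw [norm_inner_symm _ x]
  by_contra hs
  have h2 := (h x).1
  rw [tsum_eq_zero_of_not_summable hs] at h2
  simp [eq_zero_of_mul_norm_sq_le_zero h1 h2, summable_zero] at hs

lemma norm_sq_l2 (v : l2 S) : ‖v‖ ^ 2 = ∑' s, ‖v s‖ ^ 2 := by
  simpa using lp.norm_rpow_eq_tsum (p := 2) (by norm_num) v

lemma memℓp_two {v : S → ℂ} (hv : Summable fun s => ‖v s‖ ^ 2) :
    Memℓp (E := fun _ : S => ℂ) v 2 :=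
  memℓp_gen (by simpa using hv)

/-- The analysis operator `x ↦ (⟨f s, x⟩)_s` of a frame. -/
lemma IsFrame.exists_analysis {f : S → H} (hf : IsFrame f) :
    ∃ Θ : H →L[ℂ] l2 S, (∀ x s, Θ x s = ⟪f s, x⟫) ∧
      ∃ c : ℝ, 0 < c ∧ ∀ x, c * ‖x‖ ^ 2 ≤ ‖Θ x‖ ^ 2 := by
  let L : H →ₗ[ℂ] l2 S :=
    { toFun := fun x => ⟨fun s => ⟪f s, x⟫, memℓp_two (hf.summable x)⟩
      map_add' := fun x y => by ext s; exact inner_add_right _ _ _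
      map_smul' := fun c x => by ext s; exact inner_smul_right _ _ _ }
  have hL : ∀ x, ‖L x‖ ^ 2 = ∑' s, ‖⟪x, f s⟫‖ ^ 2 := fun x => by
    rw [norm_sq_l2]
    exact tsum_congr fun s => by rw [norm_inner_symm]; rfl
  obtain ⟨C₁, C₂, h1, h12, h⟩ := hf
  refine ⟨L.mkContinuous (√C₂) fun x => ?_, fun x s => rfl, C₁, h1, fun x => ?_⟩
  · refine le_of_sq_le_sq ?_ (by positivity)
    rw [hL, mul_pow, Real.sq_sqrt (h1.le.trans h12)]
    exact (h x).2
  · exact (h x).1.trans_eq (hL x).symm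

variable [CompleteSpace H]

/-- The frame operator of a frame is invertible. -/
lemma isUnit_adjoint_mul_self {K : Type*} [NormedAddCommGroup K] [InnerProductSpace ℂ K]
    [CompleteSpace K] (Θ : H →L[ℂ] K) {c : ℝ} (hc : 0 < c)
    (h : ∀ x, c * ‖x‖ ^ 2 ≤ ‖Θ x‖ ^ 2) :
    IsUnit ((ContinuousLinearMap.adjoint Θ).comp Θ) := by
  refine ContinuousLinearMap.isUnit_of_forall_le_norm_inner_map _ (c := ⟨c, hc.le⟩) hc
    fun x => ?_
  rw [ContinuousLinearMap.comp_apply, ContinuousLinearMap.adjoint_inner_left,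
    inner_self_eq_norm_sq_to_K]
  have hn : ‖((‖Θ x‖ : ℂ)) ^ 2‖ = ‖Θ x‖ ^ 2 := by simp
  exact (mul_comm _ _).trans_le ((h x).trans_eq hn.symm)

end Frame

section Representation

variable {G H : Type*} [NormedAddCommGroup H] [InnerProductSpace ℂ H] [CompleteSpace H]

/-- An intertwiner fixing a frame vector is the identity. -/
lemma eq_one_of_intertwines {π : G → (H →L[ℂ] H)} {ξ : H} (hξ : IsFrame fun g => π g ξ)
    {T : H →L[ℂ] H} (hT : ∀ g, T * π g = π g * T) (hTξ : T ξ = ξ) : T = 1 := by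
  obtain ⟨Θ, hΘ, c, hc, hcΘ⟩ := hξ.exists_analysis
  rw [← (ContinuousLinearMap.adjoint).injective.eq_iff, ← sub_eq_zero]
  ext x
  have h1 : Θ (ContinuousLinearMap.adjoint T x - x) = 0 := by
    ext g
    have h2 : T (π g ξ) = π g ξ := by
      have := DFunLike.congr_fun (hT g) ξ
      simpa [hTξ] using this
    rw [hΘ, inner_sub_right, ContinuousLinearMap.adjoint_inner_right, h2, sub_self]
    rfl
  have h2 := hcΘ (ContinuousLinearMap.adjoint T x - x)
  rw [h1, norm_zero, zero_pow two_ne_zero] at h2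
  have h4 := eq_zero_of_mul_norm_sq_le_zero hc h2
  simpa [← ContinuousLinearMap.star_eq_adjoint] using h4

variable [Group G]

open ContinuousLinearMap in
/-- The mixed frame operator `x ↦ ∑ g, ⟨π g ξ, x⟩ π g η` intertwines `π` with its contragredient. -/
lemma mixed_frame_operator_comm {π : G → (H →L[ℂ] H)} (hπ : IsRepn π) {ξ η : H}
    {Θ Φ : H →L[ℂ] l2 G} (hΘ : ∀ x g, Θ x g = ⟪π g ξ, x⟫) (hΦ : ∀ x g, Φ x g = ⟪π g η, x⟫)
    (h : G) :
    (adjoint Φ).comp Θ * adjoint (π h⁻¹) = π h * (adjoint Φ).comp Θ := by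
  ext x
  refine ext_inner_right ℂ fun y => ?_
  simp only [mul_apply_eq_comp, comp_apply, adjoint_inner_left]
  rw [← adjoint_inner_right (π h), adjoint_inner_left, lp.inner_eq_tsum, lp.inner_eq_tsum,
    ← (Equiv.mulLeft h).tsum_eq]
  refine tsum_congr fun g => ?_
  simp only [hΘ, hΦ, adjoint_inner_right, Equiv.coe_mulLeft, ← mul_apply_eq_comp, ← hπ.2,
    inv_mul_cancel_left]

open ContinuousLinearMap in
/-- One half of the centrality of frame representations of abelian groups: an intertwiner
carrying `ξ` to `η`. -/
lemma exists_intertwiner (hG : ∀ a b : G, a * b = b * a) {π : G → (H →L[ℂ] H)} (hπ : IsRepn π)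
    {ξ η : H} (hξ : IsFrame fun g => π g ξ) (hη : IsFrame fun g => π g η) :
    ∃ T : H →L[ℂ] H, (∀ g, T * π g = π g * T) ∧ T ξ = η := by
  obtain ⟨Θ, hΘ, c, hc, hcΘ⟩ := hξ.exists_analysis
  obtain ⟨Φ, hΦ, -⟩ := hη.exists_analysis
  obtain ⟨F, hF⟩ := isUnit_adjoint_mul_self Θ hc hcΘ
  set R : H →L[ℂ] H := ↑F⁻¹ with hR
  have hFR : (F : H →L[ℂ] H) * R = 1 := F.mul_inv
  have hRF : R * (F : H →L[ℂ] H) = 1 := F.inv_mul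
  have hFcomm : ∀ h, (F : H →L[ℂ] H) * adjoint (π h⁻¹) = π h * F := fun h => by
    rw [hF]; exact mixed_frame_operator_comm hπ hΘ hΘ h
  have hRcomm : ∀ h, R * π h = adjoint (π h⁻¹) * R := fun h => by
    calc R * π h = R * (π h * F) * R := by rw [mul_assoc, mul_assoc, hFR, mul_one]
      _ = (R * F) * adjoint (π h⁻¹) * R := by rw [← hFcomm]; simp only [mul_assoc]
      _ = _ := by rw [hRF, one_mul]
  have hRsa : ∀ x y, ⟪R x, y⟫ = ⟪x, R y⟫ := by
    have hFsa : ∀ x y, ⟪(F : H →L[ℂ] H) x, y⟫ = ⟪x, (F : H →L[ℂ] H) y⟫ := fun x y => by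
      rw [hF, comp_apply, comp_apply, adjoint_inner_left, adjoint_inner_right]
    intro x y
    have h1 : ∀ z, (F : H →L[ℂ] H) (R z) = z := fun z => DFunLike.congr_fun hFR z
    conv_rhs => rw [← h1 x]
    rw [hFsa, h1]
  have hRcomm' : ∀ h x, R (π h x) = adjoint (π h⁻¹) (R x) := fun h x =>
    DFunLike.congr_fun (hRcomm h) x
  refine ⟨(adjoint Φ).comp Θ * R, fun g => ?_, ?_⟩
  · rw [mul_assoc, hRcomm, ← mul_assoc, mixed_frame_operator_comm hπ hΘ hΦ, mul_assoc]
  have hspan : ∀ x : H, (∀ k, ⟪x, R (π k ξ)⟫ = 0) → x = 0 := fun x hx => by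
    have h1 : Θ (R x) = 0 := by
      ext k
      rw [hΘ, ← inner_conj_symm, hRsa, hx]
      simp
    have h2 := hcΘ (R x)
    rw [h1, norm_zero, zero_pow two_ne_zero] at h2
    have h3 := eq_zero_of_mul_norm_sq_le_zero hc h2
    have h4 : (F : H →L[ℂ] H) (R x) = x := DFunLike.congr_fun hFR x
    rw [← h4, h3, map_zero]
  refine sub_eq_zero.mp (hspan _ fun k => ?_)
  rw [inner_sub_left, sub_eq_zero]
  have h5 : (F : H →L[ℂ] H) (R η) = η := DFunLike.congr_fun hFR η
  conv_rhs => rw [← h5, hF]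
  simp only [mul_apply_eq_comp, comp_apply, adjoint_inner_left, lp.inner_eq_tsum]
  rw [← ((Equiv.inv G).trans (Equiv.mulLeft k)).tsum_eq]
  refine tsum_congr fun g => ?_
  simp only [hΘ, hΦ, Equiv.trans_apply, Equiv.inv_apply, Equiv.coe_mulLeft]
  have e1 : ⟪π (k * g⁻¹) ξ, R ξ⟫ = ⟪R (π k ξ), π g ξ⟫ := by
    rw [hG, hπ.2, mul_apply_eq_comp, ← adjoint_inner_right, ← hRcomm', hRsa]
  have e2 : ⟪π (k * g⁻¹) η, R (π k ξ)⟫ = ⟪R η, π g ξ⟫ := by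
    rw [hRcomm', adjoint_inner_right, ← mul_apply_eq_comp, ← hπ.2, inv_mul_cancel_left,
      ← adjoint_inner_right, ← hRcomm', hRsa]
  rw [e1, e2, RCLike.inner_apply, RCLike.inner_apply, inner_conj_symm, inner_conj_symm, mul_comm]

/-- Frame representations of abelian groups are central. -/
lemma isCentral_of_mul_comm (hG : ∀ a b : G, a * b = b * a) {π : G → (H →L[ℂ] H)}
    (hπ : IsRepn π) : IsCentral π := by
  intro ξ η hξ hη
  obtain ⟨T, hT, hTξ⟩ := exists_intertwiner hG hπ hξ hη
  obtain ⟨T', hT', hTη⟩ := exists_intertwiner hG hπ hη hξ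
  have h1 : T' * T = 1 := eq_one_of_intertwines hξ
    (fun g => by rw [mul_assoc, hT, ← mul_assoc, hT', mul_assoc])
    (by rw [mul_apply_eq_comp, hTξ, hTη])
  have h2 : T * T' = 1 := eq_one_of_intertwines hη
    (fun g => by rw [mul_assoc, hT', ← mul_assoc, hT, mul_assoc])
    (by rw [mul_apply_eq_comp, hTη, hTξ])
  exact ⟨ContinuousLinearEquiv.equivOfInverse T T' (fun x => DFunLike.congr_fun h1 x)
    (fun x => DFunLike.congr_fun h2 x), fun g x => DFunLike.congr_fun (hT g) x, hTξ⟩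

end Representation

section Permutation

variable {S : Type*}

/-- The unitary operator on `ℓ²(S)` permuting the coordinates by `σ`. -/
def l2Perm (σ : Equiv.Perm S) : l2 S →L[ℂ] l2 S :=
  LinearIsometry.toContinuousLinearMap
    { toFun := fun v => ⟨fun s => v (σ⁻¹ s), memℓp_two (by
        have h := (lp.memℓp v).summable (by norm_num)
        exact (Equiv.summable_iff σ⁻¹).mpr (by simpa using h))⟩
      map_add' := fun v w => rfl
      map_smul' := fun c v => rfl
      norm_map' := fun v => by
        rw [← sq_eq_sq₀ (norm_nonneg _) (norm_nonneg _), norm_sq_l2, norm_sq_l2]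
        exact Equiv.tsum_eq σ⁻¹ fun s => ‖v s‖ ^ 2 }

lemma l2Perm_apply (σ : Equiv.Perm S) (v : l2 S) (s : S) : l2Perm σ v s = v (σ⁻¹ s) := rfl

lemma l2Perm_mul (σ τ : Equiv.Perm S) : l2Perm (σ * τ) = l2Perm σ * l2Perm τ := by
  ext v s
  simp only [mul_apply_eq_comp, l2Perm_apply, mul_inv_rev, Equiv.Perm.mul_apply]

lemma adjoint_l2Perm (σ : Equiv.Perm S) :
    ContinuousLinearMap.adjoint (l2Perm σ) = l2Perm σ⁻¹ := by
  symm
  rw [ContinuousLinearMap.eq_adjoint_iff]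
  intro v w
  rw [lp.inner_eq_tsum, lp.inner_eq_tsum, ← Equiv.tsum_eq σ⁻¹]
  refine tsum_congr fun s => ?_
  rw [l2Perm_apply, l2Perm_apply, inv_inv]
  exact congrArg (⟪v ·, w (σ⁻¹ s)⟫) (σ.apply_symm_apply s)

lemma inner_sdelta [DecidableEq S] (v : l2 S) (s : S) : ⟪sdelta s, v⟫ = v s := by
  simp [sdelta, lp.inner_single_left]

lemma l2Perm_sdelta [DecidableEq S] (σ : Equiv.Perm S) (s : S) :
    l2Perm σ (sdelta s) = sdelta (σ s) := by
  ext t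
  rw [l2Perm_apply]
  simp only [sdelta, lp.single_apply, Pi.single_apply, Equiv.Perm.inv_eq_iff_eq]

lemma separableSpace_l2 [Countable S] : TopologicalSpace.SeparableSpace (l2 S) := by
  let b : HilbertBasis S ℂ (l2 S) := default
  have h := ((Set.countable_range b).isSeparable.span (R := ℂ)).closure
  rw [← Submodule.topologicalClosure_coe, b.dense_span, Submodule.top_coe] at h
  exact TopologicalSpace.isSeparable_univ_iff.mp h

end Permutation

section NonAbelian

variable {G : Type} [Group G]

/-- The left regular representation. -/
def leftReg (g : G) : l2 G →L[ℂ] l2 G := l2Perm (Equiv.mulLeft g)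

lemma leftReg_mul (g h : G) : leftReg (g * h) = leftReg g * leftReg h := by
  rw [leftReg, leftReg, leftReg, ← l2Perm_mul]
  congr 1
  ext
  simp

lemma adjoint_leftReg (g : G) :
    ContinuousLinearMap.adjoint (leftReg g) = leftReg g⁻¹ := by
  rw [leftReg, adjoint_l2Perm, leftReg]
  exact congrArg l2Perm (Equiv.ext fun _ => rfl)

open ContinuousLinearMap in
/-- If all frame representations are central, the commutant of the left regular representation
has no nonzero element of square zero. -/
lemma eq_zero_of_commute_leftReg [Countable G]
    (hcen : ∀ (H : Type) [NormedAddCommGroup H] [InnerProductSpace ℂ H] [CompleteSpace H]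
        [TopologicalSpace.SeparableSpace H] (π : G → (H →L[ℂ] H)),
        IsRepn π → (∃ ξ : H, IsFrame fun g => π g ξ) → IsCentral π)
    {X : l2 G →L[ℂ] l2 G} (hX : ∀ g, X * leftReg g = leftReg g * X) (hX2 : X * X = 0) :
    X = 0 := by
  classical
  have hX2' : ∀ v, X (X v) = 0 := fun v => DFunLike.congr_fun hX2 v
  set K : Submodule ℂ (l2 G) := LinearMap.ker X.toLinearMap with hK
  have hKc : IsClosed (K : Set (l2 G)) := X.isClosed_ker
  have : CompleteSpace K := hKc.completeSpace_coe
  have := separableSpace_l2 (S := G)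
  have : SecondCountableTopology (l2 G) := UniformSpace.secondCountable_of_separable _
  set M : Submodule ℂ (l2 G) := Kᗮ with hM
  have hinv : ∀ (g : G), ∀ v ∈ M, leftReg g v ∈ M := fun g v hv => by
    rw [hM, Submodule.mem_orthogonal] at hv ⊢
    intro w hw
    rw [← adjoint_inner_left, adjoint_leftReg]
    refine hv _ ?_
    have h := DFunLike.congr_fun (hX g⁻¹) w
    have hw' : X w = 0 := hw
    simp only [mul_apply_eq_comp, hw', map_zero] at h
    exact h
  let P := M.orthogonalProjectionOnto
  have hP : ∀ (m : M) (v : l2 G), ⟪m, P v⟫ = ⟪(m : l2 G), v⟫ := fun m v => by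
    simp [P]
  let π : G → (M →L[ℂ] M) := fun g => P.comp ((leftReg g).comp M.subtypeL)
  have hπ_coe : ∀ g (m : M), (π g m : l2 G) = leftReg g m := fun g m => by
    have : P (leftReg g m) = ⟨_, hinv g m m.2⟩ :=
      Submodule.orthogonalProjectionOnto_mem_subspace_eq_self (⟨_, hinv g m m.2⟩ : M)
    exact congrArg Subtype.val this
  have hπ : IsRepn π := by
    refine ⟨?_, fun g h => ?_⟩
    · ext1 m
      apply Subtype.ext
      rw [hπ_coe, leftReg, Equiv.mulLeft_one]
      rfl
    · ext1 m
      apply Subtype.ext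
      rw [mul_apply_eq_comp, hπ_coe, hπ_coe, hπ_coe, leftReg_mul]
      rfl
  have hinner : ∀ W : l2 G →L[ℂ] l2 G, (∀ g, W * leftReg g = leftReg g * W) →
      ∀ (m : M) (g : G), ⟪π g (P (adjoint W (sdelta 1))), m⟫ = W m g := by
    intro W hW m g
    have h1 : ⟪π g (P (adjoint W (sdelta 1))), m⟫
        = ⟪P (adjoint W (sdelta 1)), (π g⁻¹ m)⟫ := by
      rw [Submodule.coe_inner, Submodule.coe_inner, hπ_coe, hπ_coe, ← adjoint_inner_right,
        adjoint_leftReg]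
    rw [h1, ← inner_conj_symm, hP, inner_conj_symm, adjoint_inner_left, hπ_coe,
      ← mul_apply_eq_comp, hW, mul_apply_eq_comp, ← adjoint_leftReg, adjoint_inner_right, leftReg,
      l2Perm_sdelta, inner_sdelta]
    simp
  have hframe : ∀ W W' : l2 G →L[ℂ] l2 G, (∀ g, W * leftReg g = leftReg g * W) → W' * W = 1 →
      IsFrame fun g => π g (P (adjoint W (sdelta 1))) := by
    intro W W' hW hW'
    have hsum : ∀ m : M, ∑' g, ‖⟪m, π g (P (adjoint W (sdelta 1)))⟫‖ ^ 2 = ‖W m‖ ^ 2 := fun m => by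
      rw [norm_sq_l2]
      exact tsum_congr fun g => by rw [norm_inner_symm, hinner W hW]
    refine ⟨(1 + ‖W'‖ ^ 2)⁻¹, 1 + ‖W‖ ^ 2, by positivity, ?_, fun m => ?_⟩
    · exact (inv_le_one_of_one_le₀ (by linarith [sq_nonneg ‖W'‖])).trans
        (by linarith [sq_nonneg ‖W‖])
    rw [hsum]
    constructor
    · have h1 : ‖m‖ ≤ ‖W'‖ * ‖W m‖ := by
        have := W'.le_opNorm (W m)
        rwa [← mul_apply_eq_comp, hW'] at this
      rw [inv_mul_le_iff₀ (by positivity)]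
      nlinarith [pow_le_pow_left₀ (norm_nonneg _) h1 2, sq_nonneg ‖W m‖]
    · have h1 : ‖W m‖ ≤ ‖W‖ * ‖m‖ := W.le_opNorm m
      nlinarith [pow_le_pow_left₀ (norm_nonneg _) h1 2, sq_nonneg ‖m‖]
  have hW1 : ∀ g, (1 + X) * leftReg g = leftReg g * (1 + X) := fun g => by
    rw [add_mul, mul_add, hX, one_mul, mul_one]
  have hframe1 := hframe 1 1 (fun g => by rw [one_mul, mul_one]) (one_mul 1)
  have hframe2 := hframe (1 + X) (1 - X) hW1 (by
    rw [sub_mul, one_mul, mul_add, hX2]; simp)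
  obtain ⟨T, hT, hTξ⟩ := hcen M π hπ ⟨_, hframe1⟩ _ _ hframe1 hframe2
  have hXM : ∀ m : M, X m = 0 := fun m => by
    have h1 : (adjoint (T : M →L[ℂ] M) m : l2 G) = m + X m := by
      ext g
      have h2 := hinner (1 + X) hW1 m g
      have h3 := hinner 1 (fun g => by rw [one_mul, mul_one]) (adjoint (T : M →L[ℂ] M) m) g
      rw [← hTξ, ← hT] at h2
      rw [adjoint_inner_right] at h3
      exact h3.symm.trans h2
    have h2 : X m ∈ M := by
      have := M.sub_mem (adjoint (T : M →L[ℂ] M) m).2 m.2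
      rwa [h1, add_sub_cancel_left] at this
    exact inner_self_eq_zero.mp (Submodule.inner_right_of_mem_orthogonal
      (show X m ∈ K from hX2' m) h2)
  have hMbot : M = ⊥ := (Submodule.eq_bot_iff _).mpr fun m hm =>
    inner_self_eq_zero.mp (Submodule.inner_right_of_mem_orthogonal
      (show m ∈ K from hXM ⟨m, hm⟩) hm)
  have hKtop : K = ⊤ := (Submodule.orthogonal_eq_bot_iff).mp hMbot
  ext1 v
  have : v ∈ K := hKtop ▸ Submodule.mem_top
  exact this

/-- If all frame representations of `G` are central, then `G` is abelian. -/
lemma mul_comm_of_forall_isCentral [Countable G]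
    (hcen : ∀ (H : Type) [NormedAddCommGroup H] [InnerProductSpace ℂ H] [CompleteSpace H]
        [TopologicalSpace.SeparableSpace H] (π : G → (H →L[ℂ] H)),
        IsRepn π → (∃ ξ : H, IsFrame fun g => π g ξ) → IsCentral π) (a b : G) :
    a * b = b * a := by
  classical
  let N : StarSubalgebra ℂ (l2 G →L[ℂ] l2 G) := StarSubalgebra.centralizer ℂ (Set.range leftReg)
  have : IsClosed (N : Set (l2 G →L[ℂ] l2 G)) := Set.isClosed_centralizer _
  have hN : ∀ X : l2 G →L[ℂ] l2 G, X ∈ N ↔ ∀ g, X * leftReg g = leftReg g * X := fun X => by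
    simp only [N, StarSubalgebra.mem_centralizer_iff, Set.forall_mem_range,
      ContinuousLinearMap.star_eq_adjoint, adjoint_leftReg]
    exact ⟨fun h g => (h g).1.symm, fun h g => ⟨(h g).symm, (h g⁻¹).symm⟩⟩
  have hR : ∀ c : G, l2Perm (Equiv.mulRight c) ∈ N := fun c => (hN _).mpr fun g => by
    rw [leftReg, ← l2Perm_mul, ← l2Perm_mul]
    congr 1
    ext
    simp [mul_assoc]
  have hcomm := mul_comm_of_forall_sq_eq_zero (A := N) (fun X hX2 => Subtype.ext
    (eq_zero_of_commute_leftReg hcen ((hN X).mp X.2) (congrArg Subtype.val hX2)))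
    ⟨_, hR b⟩ ⟨_, hR a⟩
  have h1 : l2Perm (Equiv.mulRight b) (l2Perm (Equiv.mulRight a) (sdelta (1 : G)))
      = l2Perm (Equiv.mulRight a) (l2Perm (Equiv.mulRight b) (sdelta 1)) :=
    DFunLike.congr_fun (congrArg Subtype.val hcomm) _
  simp only [l2Perm_sdelta, Equiv.coe_mulRight, one_mul] at h1
  by_contra hab
  have h2 := congrArg (fun v : l2 G => v (a * b)) h1
  simp [sdelta, hab] at h2

end NonAbelian

/-- For a countable group `G`, every frame representation of `G` on a
separable complex Hilbert space is central if and only if `G` is abelian. -/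
theorem statement18 (G : Type) [Group G] [Countable G] :
    (∀ (H : Type) [NormedAddCommGroup H] [InnerProductSpace ℂ H] [CompleteSpace H]
        [TopologicalSpace.SeparableSpace H] (π : G → (H →L[ℂ] H)),
        IsRepn π → (∃ ξ : H, IsFrame fun g => π g ξ) → IsCentral π) ↔
      ∀ a b : G, a * b = b * a := by
  refine ⟨fun h => mul_comm_of_forall_isCentral h, fun hG H _ _ _ _ π hπ _ => ?_⟩
  exact isCentral_of_mul_comm hG hπ
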